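/- Let α ∈ ℝ\ℤ, k ∈ ℤ, and a, b, c > 0, and write β = |α+k|. Then Σ_{m=0}^∞ e^{−cm} (m!/Γ(m+β+1)) binom(m+β, m)² P_{k,m}(a) P_{k,m}(b) = (e^{βc/2} / ((ab)^{β/2}(1−e^{−c}))) · exp(−(a+b)e^{−c}/(1−e^{−c})) · I_β(2√(ab) e^{−c/2}/(1−e^{−c})), where binom(m+β, m) = Γ(m+β+1)/(m! Γ(β+1)). -/

import Mathlib

noncomputable section

/-- The Pochhammer symbol `(a)_n = a(a+1)⋯(a+n−1)`. -/
def poch (a : ℝ) (n : ℕ) : ℝ := (ascPochhammer ℝ n).eval a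

/-- The polynomial `P_{k,m}(r) = Σ_{n=0}^m [(−m)_n / (1+|k+α|)_n] r^n/n!`. -/
def Pkm (α : ℝ) (k : ℤ) (m : ℕ) (r : ℝ) : ℝ :=
  ∑ n ∈ Finset.range (m + 1),
    poch (-(m : ℝ)) n / poch (1 + |(k : ℝ) + α|) n * r ^ n / n.factorial

/-- The modified Bessel function `I_ν(z)` for real argument, defined by its power series. -/
def besselIR (ν z : ℝ) : ℝ :=
  ∑' n : ℕ, (z / 2) ^ ((2 * n + ν : ℝ)) / (n.factorial * Real.Gamma (n + ν + 1))

theorem poch_zero (a : ℝ) : poch a 0 = 1 := by simp [poch]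

theorem poch_succ_left (a : ℝ) (n : ℕ) : poch a (n + 1) = a * poch (a + 1) n := by
  simp [poch, ascPochhammer_succ_left]

theorem poch_succ_right (a : ℝ) (n : ℕ) : poch a (n + 1) = poch a n * (a + n) :=
  ascPochhammer_succ_eval n a

theorem poch_pos {a : ℝ} (ha : 0 < a) (n : ℕ) : 0 < poch a n := ascPochhammer_pos n a ha

theorem poch_neg_natCast (m n : ℕ) : poch (-(m : ℝ)) n = (-1) ^ n * n.factorial * m.choose n := by
  rw [poch, ascPochhammer_eval_neg_eq_descPochhammer, descPochhammer_eval_eq_descFactorial,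
    Nat.descFactorial_eq_factorial_mul_choose]
  push_cast
  ring

theorem Gamma_add_eq_poch {a : ℝ} (ha : 0 < a) (n : ℕ) :
    Real.Gamma (a + n) = poch a n * Real.Gamma a := by
  induction n with
  | zero => simp [poch_zero]
  | succ n ih =>
    have h : a + n ≠ 0 := by positivity
    rw [Nat.cast_succ, ← add_assoc, Real.Gamma_add_one h, ih, poch_succ_right]
    ring

/-- The binomial series `∑ (γ)_m t^m / m! = (1 - t)^(-γ)`. -/
theorem hasSum_poch_pow (γ : ℝ) {t : ℝ} (ht : |t| < 1) :
    HasSum (fun m : ℕ ↦ t ^ m * (poch γ m / m.factorial)) ((1 - t) ^ (-γ)) := by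
  have h := (Real.one_div_one_sub_rpow_hasFPowerSeriesOnBall_zero γ).hasSum (y := t)
    (by simpa [enorm_eq_nnnorm, ← NNReal.coe_lt_coe] using ht)
  have h1 : 0 ≤ 1 - t := by linarith [(abs_lt.1 ht).2]
  rw [zero_add, one_div, ← Real.rpow_neg h1] at h
  convert! h using 2 with m
  have := Ring.factorial_nsmul_multichoose_eq_ascPochhammer γ m
  rw [Polynomial.ascPochhammer_smeval_eq_eval, Ring.multichoose_eq, nsmul_eq_mul] at this
  simp only [FormalMultilinearSeries.ofScalars_apply_eq, smul_eq_mul, poch, ← this]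
  field_simp

theorem HasSum.poch_choose_succ {γ t S : ℝ} {i : ℕ} {g g' : ℕ → ℝ} (hg : ∀ m, g' (m + 1) = g m)
    (h : HasSum (fun m : ℕ ↦ t ^ m * (poch (γ + 1) m / m.factorial) * (m.choose i * g m)) S) :
    HasSum (fun m : ℕ ↦ t ^ m * (poch γ m / m.factorial) * (m.choose (i + 1) * g' m))
      (γ * t / (i + 1) * S) := by
  rw [← hasSum_nat_add_iff' 1]
  simp only [Finset.range_one, Finset.sum_singleton, Nat.choose_zero_succ, Nat.cast_zero, zero_mul,
    mul_zero, sub_zero]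
  convert! h.mul_left (γ * t / (i + 1)) using 2 with m
  have hc : ((m : ℝ) + 1) * m.choose i = (m + 1).choose (i + 1) * (i + 1) := by
    exact_mod_cast Nat.add_one_mul_choose_eq m i
  rw [hg, poch_succ_left, Nat.factorial_succ, Nat.cast_mul, Nat.cast_succ,
    show ((m + 1).choose (i + 1) : ℝ) = (m + 1) * m.choose i / (i + 1) by rw [hc]; field_simp]
  field_simp
  ring

/-- The polynomial `∑ n! C(i,n) C(j,n) s^n / (γ)_n`, i.e. `₂F₁(-i, -j; γ; s)`. -/
def chuPoly (γ s : ℝ) (i j : ℕ) : ℝ :=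
  ∑ n ∈ Finset.range (i + 1), i.choose n * j.choose n * n.factorial / poch γ n * s ^ n

theorem chuPoly_zero_left (γ s : ℝ) (j : ℕ) : chuPoly γ s 0 j = 1 := by
  simp [chuPoly, poch_zero]

theorem chuPoly_zero_right (γ s : ℝ) (i : ℕ) : chuPoly γ s i 0 = 1 := by
  simp [chuPoly, Finset.sum_range_succ', poch_zero]

theorem chuPoly_eq_sum (γ s : ℝ) {i N : ℕ} (h : i < N) (j : ℕ) : chuPoly γ s i j =
    ∑ n ∈ Finset.range N, i.choose n * j.choose n * n.factorial / poch γ n * s ^ n := by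
  refine Finset.sum_subset (by simpa using h) fun n _ hn ↦ ?_
  rw [Nat.choose_eq_zero_of_lt (by simpa using hn)]
  simp

theorem cast_choose_succ_mul (i n : ℕ) :
    (i.choose (n + 1) : ℝ) * (n + 1) = i.choose n * (i - n) := by
  rcases le_or_gt n i with h | h
  · have := Nat.choose_succ_right_eq i n
    rw [← Nat.cast_sub h]
    exact_mod_cast this
  · simp [Nat.choose_eq_zero_of_lt h, Nat.choose_eq_zero_of_lt (h.trans n.lt_succ_self)]

theorem chuPoly_succ_succ {γ : ℝ} (hγ : 0 < γ) (s : ℝ) (i j : ℕ) :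
    γ * chuPoly γ s (i + 1) (j + 1) =
      (γ + j + 1) * chuPoly (γ + 1) s i (j + 1) + (j + 1) * (s - 1) * chuPoly (γ + 1) s i j := by
  have key (n : ℕ) :
      γ * ((i + 1).choose (n + 1) * (j + 1).choose (n + 1) * (n + 1).factorial /
          poch γ (n + 1) * s ^ (n + 1)) =
      (γ + j + 1) * (i.choose (n + 1) * (j + 1).choose (n + 1) * (n + 1).factorial /
          poch (γ + 1) (n + 1) * s ^ (n + 1)) +
      (j + 1) * s * (i.choose n * j.choose n * n.factorial / poch (γ + 1) n * s ^ n) -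
      (j + 1) * (i.choose (n + 1) * j.choose (n + 1) * (n + 1).factorial /
          poch (γ + 1) (n + 1) * s ^ (n + 1)) := by
    have h1 := poch_pos (show 0 < γ + 1 by linarith) n
    have hn : (0 : ℝ) < γ + 1 + n := by positivity
    have hi : (i.choose (n + 1) : ℝ) = i.choose n * (i - n) / (n + 1) := by
      rw [← cast_choose_succ_mul]; field_simp
    have hj : (j.choose (n + 1) : ℝ) = j.choose n * (j - n) / (n + 1) := by
      rw [← cast_choose_succ_mul]; field_simp
    rw [poch_succ_left γ, poch_succ_right (γ + 1), Nat.factorial_succ, Nat.choose_succ_succ,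
      Nat.choose_succ_succ]
    push_cast
    rw [hi, hj]
    field_simp
    ring
  have hi : i < i + 1 + 1 := by omega
  rw [chuPoly_eq_sum γ s (i + 1).lt_succ_self, chuPoly_eq_sum _ s hi, mul_sub, sub_mul, mul_one,
    chuPoly_eq_sum _ s hi]
  conv_rhs => enter [2, 1]; rw [← chuPoly_eq_sum _ s hi, chuPoly]
  iterate 3 rw [Finset.sum_range_succ' _ (i + 1)]
  simp only [mul_add, Finset.mul_sum, key, Finset.sum_add_distrib, Finset.sum_sub_distrib]
  simp [poch_zero]
  ring

theorem hasSum_poch_choose_choose {t : ℝ} (ht0 : 0 < t) (ht1 : t < 1) (i j : ℕ) {γ : ℝ}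
    (hγ : 0 < γ) :
    HasSum (fun m : ℕ ↦ t ^ m * (poch γ m / m.factorial) * (m.choose i * m.choose j))
      ((1 - t) ^ (-(γ + (i + j : ℕ))) * (poch γ i * poch γ j / (i.factorial * j.factorial)) *
        t ^ (i + j) * chuPoly γ t⁻¹ i j) := by
  have h1t : 0 < 1 - t := by linarith
  induction i generalizing j γ with
  | zero =>
    induction j generalizing γ with
    | zero =>
      simpa [chuPoly_zero_left, poch_zero] using
        hasSum_poch_pow γ (abs_lt.2 ⟨by linarith, ht1⟩)
    | succ j ih =>
      have h := ih (γ := γ + 1) (by linarith)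
      simp only [mul_comm ((Nat.choose _ 0 : ℕ) : ℝ)] at h ⊢
      convert HasSum.poch_choose_succ (g' := fun m ↦ (m.choose 0 : ℝ)) (by simp) h using 1
      simp only [chuPoly_zero_left, poch_succ_left γ, Nat.factorial_succ]
      push_cast
      rw [show -(γ + (0 + (j + 1 : ℝ))) = -(γ + 1 + (0 + j)) by ring]
      simp only [zero_add, pow_succ, poch_zero]
      field_simp
  | succ i ih =>
    cases j with
    | zero =>
      have h := ih 0 (γ := γ + 1) (by linarith)
      convert HasSum.poch_choose_succ (g' := fun m ↦ (m.choose 0 : ℝ)) (by simp) h using 1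
      simp only [chuPoly_zero_right, poch_succ_left γ, Nat.factorial_succ]
      push_cast
      rw [show -(γ + ((i + 1 : ℝ) + 0)) = -(γ + 1 + (i + 0)) by ring]
      simp only [add_zero, pow_succ, poch_zero]
      field_simp
    | succ j =>
      have h := (ih (j + 1) (γ := γ + 1) (by linarith)).add (ih j (γ := γ + 1) (by linarith))
      simp only [← mul_add] at h
      convert HasSum.poch_choose_succ (g' := fun m ↦ (m.choose (j + 1) : ℝ))
        (fun m ↦ by rw [Nat.choose_succ_succ]; push_cast; ring) h using 1
      have hc : chuPoly γ t⁻¹ (i + 1) (j + 1) = ((γ + j + 1) * chuPoly (γ + 1) t⁻¹ i (j + 1) +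
          (j + 1) * (t⁻¹ - 1) * chuPoly (γ + 1) t⁻¹ i j) / γ := by
        rw [← chuPoly_succ_succ hγ]; field_simp
      have hr : (1 - t) ^ (-(γ + 1 + ((i + j : ℕ) : ℝ))) =
          (1 - t) * (1 - t) ^ (-(γ + 1 + ((i + (j + 1) : ℕ) : ℝ))) := by
        rw [show -(γ + 1 + ((i + j : ℕ) : ℝ)) = 1 + -(γ + 1 + ((i + (j + 1) : ℕ) : ℝ)) by
          push_cast; ring, Real.rpow_add h1t, Real.rpow_one]
      rw [hc, hr, show -(γ + ((i + 1 + (j + 1) : ℕ) : ℝ)) =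
        -(γ + 1 + ((i + (j + 1) : ℕ) : ℝ)) by push_cast; ring,
        poch_succ_left γ i, poch_succ_left γ j, poch_succ_right (γ + 1) j]
      simp only [Nat.factorial_succ]
      push_cast
      field_simp
      ring

theorem one_le_poch {a : ℝ} (ha : 1 ≤ a) (n : ℕ) : 1 ≤ poch a n := by
  induction n with
  | zero => rw [poch_zero]
  | succ n ih =>
    rw [poch_succ_right]
    exact one_le_mul_of_one_le_of_one_le ih (by linarith [n.cast_nonneg (α := ℝ)])

theorem summable_norm_pow_div_factorial_mul_poch {γ : ℝ} (hγ : 1 ≤ γ) (z : ℝ) :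
    Summable fun n : ℕ ↦ ‖z ^ n / (n.factorial * poch γ n)‖ := by
  refine .of_nonneg_of_le (fun _ ↦ norm_nonneg (_ : ℝ)) (fun n ↦ ?_)
    (Real.summable_pow_div_factorial z).norm
  have h := one_le_poch hγ n
  rw [norm_div, norm_div, norm_mul, Real.norm_of_nonneg (zero_le_one.trans h : 0 ≤ poch γ n),
    Real.norm_natCast]
  gcongr
  exact le_mul_of_one_le_right (by positivity) h

theorem HasSum.mul_mul_of_summable_norm {ι κ μ : Type*} {f : ι → ℝ} {g : κ → ℝ} {h : μ → ℝ}
    {a b c : ℝ} (hf : HasSum f a) (hg : HasSum g b) (hh : HasSum h c)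
    (hf' : Summable fun i ↦ ‖f i‖) (hg' : Summable fun i ↦ ‖g i‖) (hh' : Summable fun i ↦ ‖h i‖) :
    HasSum (fun q : (ι × κ) × μ ↦ f q.1.1 * g q.1.2 * h q.2) (a * b * c) := by
  have hfg := hf'.mul_norm hg'
  exact (hf.mul hg hfg.of_norm).mul hh (hfg.mul_norm hh').of_norm

theorem hasSum_pow_mul_pow_mul_chuPoly {γ : ℝ} (hγ : 1 ≤ γ) (x y s : ℝ) :
    HasSum (fun p : ℕ × ℕ ↦
        x ^ p.1 * y ^ p.2 / (p.1.factorial * p.2.factorial) * chuPoly γ s p.1 p.2)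
      (Real.exp x * Real.exp y * ∑' n : ℕ, (x * y * s) ^ n / (n.factorial * poch γ n)) := by
  have hexp (z : ℝ) : HasSum (fun n : ℕ ↦ z ^ n / n.factorial) (Real.exp z) := by
    rw [Real.exp_eq_exp_ℝ]
    exact NormedSpace.expSeries_div_hasSum_exp z
  have hx := (Real.summable_pow_div_factorial x).norm
  have hy := (Real.summable_pow_div_factorial y).norm
  have hz := summable_norm_pow_div_factorial_mul_poch hγ (x * y * s)
  have hsum := (hexp x).mul_mul_of_summable_norm (hexp y) hz.of_norm.hasSum hx hy hz
  let f : (ℕ × ℕ) × ℕ → ℝ := fun q ↦ x ^ q.1.1 * y ^ q.1.2 / (q.1.1.factorial * q.1.2.factorial) *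
    (q.1.1.choose q.2 * q.1.2.choose q.2 * q.2.factorial / poch γ q.2 * s ^ q.2)
  let φ : (ℕ × ℕ) × ℕ → (ℕ × ℕ) × ℕ := fun q ↦ ((q.1.1 + q.2, q.1.2 + q.2), q.2)
  have hφ : Function.Injective φ := by
    rintro ⟨⟨p, q⟩, n⟩ ⟨⟨p', q'⟩, n'⟩ h
    simp only [φ, Prod.mk.injEq] at h ⊢
    omega
  have hf : HasSum f
      (Real.exp x * Real.exp y * ∑' n : ℕ, (x * y * s) ^ n / (n.factorial * poch γ n)) := by
    rw [← hφ.hasSum_iff]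
    · convert! hsum using 2 with q
      obtain ⟨⟨p, q⟩, n⟩ := q
      have h := poch_pos (zero_lt_one.trans_le hγ) n
      have hfac (k : ℕ) : ((k + n).factorial : ℝ) =
          (k + n).choose n * (k.factorial * n.factorial) := by
        exact_mod_cast (Nat.add_choose_mul_factorial_mul_factorial k n).symm.trans (mul_assoc _ _ _)
      have hpos (k : ℕ) : (0 : ℝ) < (k + n).choose n := by
        exact_mod_cast Nat.choose_pos (Nat.le_add_left n k)
      have hp := hpos p
      have hq := hpos q
      simp only [f, φ, Function.comp_apply, hfac]
      field_simp
      ring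
    · rintro ⟨⟨i, j⟩, n⟩ h
      have h' : i < n ∨ j < n := by
        by_contra! h'
        exact h ⟨((i - n, j - n), n), by simp [φ, h'.1, h'.2]⟩
      rcases h' with h' | h' <;> simp [f, Nat.choose_eq_zero_of_lt h']
  refine hf.prod_fiberwise fun p ↦ ?_
  rw [chuPoly, Finset.mul_sum]
  refine hasSum_sum_of_ne_finset_zero fun n hn ↦ ?_
  simp [f, Nat.choose_eq_zero_of_lt (show p.1 < n by simpa using hn)]

/-- The polynomial `₁F₁(-m; γ; -x)`. -/
def kummerPoly (γ : ℝ) (m : ℕ) (x : ℝ) : ℝ :=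
  ∑ i ∈ Finset.range (m + 1), m.choose i * (x ^ i / poch γ i)

theorem hasSum_choose_mul_choose {γ : ℝ} (m : ℕ) (x y : ℝ) :
    HasSum (fun p : ℕ × ℕ ↦ m.choose p.1 * (x ^ p.1 / poch γ p.1) *
        (m.choose p.2 * (y ^ p.2 / poch γ p.2))) (kummerPoly γ m x * kummerPoly γ m y) := by
  rw [kummerPoly, kummerPoly, Finset.sum_mul_sum, ← Finset.sum_product']
  refine hasSum_sum_of_ne_finset_zero fun p hp ↦ ?_
  have hp' : m < p.1 ∨ m < p.2 := by
    simp only [Finset.mem_product, Finset.mem_range] at hp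
    omega
  rcases hp' with h | h <;> simp [Nat.choose_eq_zero_of_lt h]

/-- The Hille–Hardy formula. -/
theorem hasSum_kummerPoly_mul_kummerPoly {γ t : ℝ} (hγ : 1 ≤ γ) (ht0 : 0 < t) (ht1 : t < 1)
    (x y : ℝ) :
    HasSum (fun m : ℕ ↦ t ^ m * (poch γ m / m.factorial) * (kummerPoly γ m x * kummerPoly γ m y))
      ((1 - t) ^ (-γ) * (Real.exp (x * t / (1 - t)) * Real.exp (y * t / (1 - t)) *
        ∑' n : ℕ, (x * y * t / (1 - t) ^ 2) ^ n / (n.factorial * poch γ n))) := by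
  have hγ0 : 0 < γ := by linarith
  have h1t : 0 < 1 - t := by linarith
  let w : (ℕ × ℕ) → ℕ → ℝ := fun p m ↦
    t ^ m * (poch γ m / m.factorial) * (m.choose p.1 * m.choose p.2)
  let W : ℕ × ℕ → ℝ := fun p ↦ (1 - t) ^ (-(γ + (p.1 + p.2 : ℕ))) *
    (poch γ p.1 * poch γ p.2 / (p.1.factorial * p.2.factorial)) *
      t ^ (p.1 + p.2) * chuPoly γ t⁻¹ p.1 p.2
  have hw (p : ℕ × ℕ) : HasSum (w p) (W p) := hasSum_poch_choose_choose ht0 ht1 p.1 p.2 hγ0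
  have hw0 (p : ℕ × ℕ) (m : ℕ) : 0 ≤ w p m := by
    have := poch_pos hγ0 m
    positivity
  let c : ℝ → ℝ → ℕ × ℕ → ℝ := fun x y p ↦ x ^ p.1 / poch γ p.1 * (y ^ p.2 / poch γ p.2)
  have hcW (x y : ℝ) : HasSum (fun p ↦ c x y p * W p)
      ((1 - t) ^ (-γ) * (Real.exp (x * t / (1 - t)) * Real.exp (y * t / (1 - t)) *
        ∑' n : ℕ, (x * y * t / (1 - t) ^ 2) ^ n / (n.factorial * poch γ n))) := by
    have h := (hasSum_pow_mul_pow_mul_chuPoly hγ (x * t / (1 - t)) (y * t / (1 - t)) t⁻¹).mul_left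
      ((1 - t) ^ (-γ))
    rw [show x * t / (1 - t) * (y * t / (1 - t)) * t⁻¹ = x * y * t / (1 - t) ^ 2 by
      field_simp] at h
    convert! h using 2 with p
    have hi := poch_pos hγ0 p.1
    have hj := poch_pos hγ0 p.2
    simp only [c, W]
    rw [neg_add, Real.rpow_add h1t, Real.rpow_neg h1t.le (p.1 + p.2 : ℕ), Real.rpow_natCast]
    simp only [div_pow, mul_pow, pow_add]
    field_simp
  have hsummable : Summable fun q : (ℕ × ℕ) × ℕ ↦ c x y q.1 * w q.1 q.2 := by
    refine .of_norm ((summable_prod_of_nonneg fun _ ↦ norm_nonneg _).2 ⟨fun p ↦ ?_, ?_⟩)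
    · exact ((hw p).summable.mul_left (c x y p)).norm
    · convert! (hcW |x| |y|).summable using 2 with p
      rw [← (hw p).tsum_eq, ← tsum_mul_left]
      refine tsum_congr fun m ↦ ?_
      rw [norm_mul, Real.norm_of_nonneg (hw0 p m)]
      simp only [c, norm_mul, norm_div, norm_pow, Real.norm_eq_abs, abs_of_pos (poch_pos hγ0 _)]
  have hF := hsummable.hasSum
  rw [(hF.prod_fiberwise fun p ↦ (hw p).mul_left (c x y p)).unique (hcW x y),
    ← (Equiv.prodComm ℕ (ℕ × ℕ)).hasSum_iff] at hF
  refine hF.prod_fiberwise fun m ↦ ?_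
  convert! (hasSum_choose_mul_choose (γ := γ) m x y).mul_left
    (t ^ m * (poch γ m / m.factorial)) using 2 with p
  simp only [Function.comp_apply, Equiv.prodComm_apply, Prod.swap_prod_mk, c, w]
  ring

theorem Pkm_eq_kummerPoly (α : ℝ) (k : ℤ) (m : ℕ) (r : ℝ) :
    Pkm α k m r = kummerPoly (|α + k| + 1) m (-r) := by
  refine Finset.sum_congr rfl fun n _ ↦ ?_
  rw [poch_neg_natCast, add_comm 1, add_comm (k : ℝ), neg_pow r]
  field_simp

theorem besselIR_eq {ν z : ℝ} (hν : 0 ≤ ν) (hz : 0 < z) :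
    besselIR ν z = (z / 2) ^ ν / Real.Gamma (ν + 1) *
      ∑' n : ℕ, ((z / 2) ^ 2) ^ n / (n.factorial * poch (ν + 1) n) := by
  rw [besselIR, ← tsum_mul_left]
  refine tsum_congr fun n ↦ ?_
  rw [add_assoc, add_comm (n : ℝ), Gamma_add_eq_poch (by linarith),
    Real.rpow_add (by positivity), ← pow_mul]
  norm_cast
  field_simp

/-- Poisson-type kernel formula for the polynomials `P_{k,m}`: for `α ∉ ℤ`, `k ∈ ℤ`,
`a, b, c > 0` and `β = |α+k|`,
`Σ_{m=0}^∞ e^{−cm} (m!/Γ(m+β+1)) binom(m+β,m)² P_{k,m}(a) P_{k,m}(b)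
  = (e^{βc/2}/((ab)^{β/2}(1−e^{−c}))) exp(−(a+b)e^{−c}/(1−e^{−c}))
    I_β(2√(ab)e^{−c/2}/(1−e^{−c}))`,
where `binom(m+β,m) = Γ(m+β+1)/(m! Γ(β+1))`. -/
theorem Pkm_poisson_kernel (α : ℝ) (hα : ∀ j : ℤ, α ≠ (j : ℝ)) (k : ℤ) (a b c : ℝ)
    (ha : 0 < a) (hb : 0 < b) (hc : 0 < c) (β : ℝ) (hβ : β = |α + (k : ℝ)|) :
    ∑' m : ℕ,
        Real.exp (-(c * m)) * (m.factorial / Real.Gamma (m + β + 1)) *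
          (Real.Gamma (m + β + 1) / (m.factorial * Real.Gamma (β + 1))) ^ 2 *
          Pkm α k m a * Pkm α k m b =
      Real.exp (β * c / 2) / ((a * b) ^ (β / 2) * (1 - Real.exp (-c))) *
        Real.exp (-((a + b) * Real.exp (-c)) / (1 - Real.exp (-c))) *
        besselIR β (2 * Real.sqrt (a * b) * Real.exp (-c / 2) / (1 - Real.exp (-c))) := by
  have hβ0 : 0 ≤ β := hβ ▸ abs_nonneg _
  set t := Real.exp (-c) with ht
  have ht0 : 0 < t := Real.exp_pos _
  have ht1 : t < 1 := Real.exp_lt_one_iff.2 (by linarith)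
  have h1t : 0 < 1 - t := by linarith
  have hΓ : 0 < Real.Gamma (β + 1) := Real.Gamma_pos_of_pos (by linarith)
  have h := (hasSum_kummerPoly_mul_kummerPoly (show 1 ≤ β + 1 by linarith) ht0 ht1 (-a)
    (-b)).mul_left (Real.Gamma (β + 1))⁻¹
  have hterm (m : ℕ) : Real.exp (-(c * m)) * (m.factorial / Real.Gamma (m + β + 1)) *
      (Real.Gamma (m + β + 1) / (m.factorial * Real.Gamma (β + 1))) ^ 2 *
        Pkm α k m a * Pkm α k m b = (Real.Gamma (β + 1))⁻¹ * (t ^ m *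
          (poch (β + 1) m / m.factorial) *
            (kummerPoly (β + 1) m (-a) * kummerPoly (β + 1) m (-b))) := by
    have hp := poch_pos (show 0 < β + 1 by linarith) m
    rw [Pkm_eq_kummerPoly, Pkm_eq_kummerPoly, ← hβ, add_assoc, add_comm (m : ℝ),
      Gamma_add_eq_poch (by linarith), ht, ← Real.exp_nat_mul,
      show (m : ℝ) * -c = -(c * m) by ring]
    field_simp
  have hz : 0 < 2 * Real.sqrt (a * b) * Real.exp (-c / 2) / (1 - t) := by positivity
  have hz2 : (2 * Real.sqrt (a * b) * Real.exp (-c / 2) / (1 - t) / 2) ^ 2 =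
      -a * -b * t / (1 - t) ^ 2 := by
    have he : Real.exp (-c / 2) ^ 2 = t := by
      rw [← Real.exp_nat_mul, ht]; congr 1; push_cast; ring
    rw [show 2 * Real.sqrt (a * b) * Real.exp (-c / 2) / (1 - t) / 2 =
      Real.sqrt (a * b) * Real.exp (-c / 2) / (1 - t) by ring, div_pow, mul_pow, he,
      Real.sq_sqrt (by positivity)]
    ring
  have hzβ : (2 * Real.sqrt (a * b) * Real.exp (-c / 2) / (1 - t) / 2) ^ β =
      (a * b) ^ (β / 2) * (Real.exp (β * c / 2))⁻¹ / (1 - t) ^ β := by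
    rw [show 2 * Real.sqrt (a * b) * Real.exp (-c / 2) / (1 - t) / 2 =
      Real.sqrt (a * b) * Real.exp (-c / 2) / (1 - t) by ring, Real.div_rpow (by positivity) h1t.le,
      Real.mul_rpow (by positivity) (by positivity), Real.sqrt_eq_rpow,
      ← Real.rpow_mul (by positivity), ← Real.exp_mul, ← Real.exp_neg]
    ring_nf
  have hab : 0 < (a * b) ^ (β / 2) := by positivity
  have hp : 0 < (1 - t) ^ β := by positivity
  rw [tsum_congr hterm, h.tsum_eq, besselIR_eq hβ0 hz, hz2, hzβ, ← Real.exp_add,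
    Real.rpow_neg h1t.le, Real.rpow_add_one h1t.ne',
    show -a * t / (1 - t) + -b * t / (1 - t) = -((a + b) * t) / (1 - t) by ring]
  field_simp
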